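/- Let t ≥ 3 and let C₁ and C₂ be additive extended perfect codes with α ≠ 0 and binary length α+2β = 2^t, both of dual type (α,β;1,δ), such that C₁ ∩ C₂ is of dual type (α,β;i,j;k). Then for each (i',j',k') ∈ {(i,j+1,k), (i,j+2,k), (i+1,j+1,k), (i+1,j+1,k+1)} there exist two additive extended perfect codes with parameters 2α and α+4β (binary length 2^(t+2)), both of dual type (2α,α+4β;1,δ+1), whose intersection is of dual type (2α,α+4β;i',j';k'). -/

import Mathlib

open scoped BigOperators

/-- `Z2` is the ring of integers modulo 2. -/
abbrev Z2 : Type := ZMod 2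

/-- `Z4` is the ring of integers modulo 4. -/
abbrev Z4 : Type := ZMod 4

/-- The ambient group `Z₂^α × Z₄^β` for additive codes. -/
abbrev Amb (α β : ℕ) : Type := (Fin α → Z2) × (Fin β → Z4)

/-- The inner product on `Z₂^α × Z₄^β`:
`⟨u,v⟩ = 2·(Σᵢ ūᵢ·v̄ᵢ) + Σⱼ uⱼ·vⱼ ∈ Z₄`, where the bar denotes the lift `0 ↦ 0`, `1 ↦ 1`
of binary coordinates into `Z₄`. -/
def addInner {α β : ℕ} (u v : Amb α β) : Z4 :=
  2 * (∑ i, ((u.1 i).val : Z4) * ((v.1 i).val : Z4)) + ∑ j, u.2 j * v.2 j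

lemma addInner_zero_left {α β : ℕ} (v : Amb α β) : addInner 0 v = 0 := by
  simp [addInner]

lemma addInner_add_left {α β : ℕ} (u u' v : Amb α β) :
    addInner (u + u') v = addInner u v + addInner u' v := by
  have key : ∀ x x' y : Z2,
      (2 : Z4) * ((((x + x').val : ℕ) : Z4) * ((y.val : ℕ) : Z4)) =
        2 * (((x.val : ℕ) : Z4) * ((y.val : ℕ) : Z4)) +
          2 * (((x'.val : ℕ) : Z4) * ((y.val : ℕ) : Z4)) := by decide
  simp only [addInner, Prod.fst_add, Prod.snd_add, Pi.add_apply, add_mul,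
    Finset.mul_sum, Finset.sum_add_distrib]
  rw [Finset.sum_congr rfl (fun i _ => key (u.1 i) (u'.1 i) (v.1 i)),
    Finset.sum_add_distrib]
  ring

lemma addInner_neg_left {α β : ℕ} (u v : Amb α β) :
    addInner (-u) v = - addInner u v := by
  have hn : ∀ x : Z2, (-x) = x := by decide
  have key : ∀ S T : Z4, 2 * S + -T = -(2 * S + T) := by decide
  simp only [addInner, Prod.fst_neg, Prod.snd_neg, Pi.neg_apply, hn, neg_mul]
  rw [Finset.sum_neg_distrib]
  exact key _ _

/-- The additive dual `C^⊥ = {u : ⟨u,v⟩ = 0 for all v ∈ C}` of an additive code `C`. -/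
def dualCode {α β : ℕ} (C : AddSubgroup (Amb α β)) : AddSubgroup (Amb α β) where
  carrier := {u | ∀ v ∈ C, addInner u v = 0}
  zero_mem' := fun v _ => addInner_zero_left v
  add_mem' := by
    intro a b ha hb v hv
    rw [addInner_add_left, ha v hv, hb v hv, add_zero]
  neg_mem' := by
    intro a ha v hv
    rw [addInner_neg_left, ha v hv, neg_zero]

/-- An additive code `C ⊆ Z₂^α × Z₄^β` is of type `(α,β;γ,δ)` when it is isomorphic,
as an abelian group, to `Z₂^γ × Z₄^δ`; equivalently (which is how we state it),
`|C| = 2^(γ+2δ)` and the number of elements `x ∈ C` with `x + x = 0` is `2^(γ+δ)`. -/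
def isOfType {α β : ℕ} (C : AddSubgroup (Amb α β)) (γ δ : ℕ) : Prop :=
  Nat.card C = 2 ^ (γ + 2 * δ) ∧
    Nat.card {x : Amb α β // x ∈ C ∧ x + x = 0} = 2 ^ (γ + δ)

/-- An additive code `C` is of type `(α,β;γ,δ;κ)` when it is of type `(α,β;γ,δ)` and
`2^κ` is the cardinality of the image of `{x ∈ C : x + x = 0}` under the projection
onto the binary coordinates. -/
def isOfTypeK {α β : ℕ} (C : AddSubgroup (Amb α β)) (γ δ κ : ℕ) : Prop :=
  isOfType C γ δ ∧
    Nat.card ↥(Prod.fst '' {x : Amb α β | x ∈ C ∧ x + x = 0}) = 2 ^ κ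

/-- The Gray map on one quaternary coordinate:
`0 ↦ (0,0)`, `1 ↦ (0,1)`, `2 ↦ (1,1)`, `3 ↦ (1,0)`. -/
def grayPhi (y : Z4) : Z2 × Z2 :=
  if y = 0 then (0, 0) else if y = 1 then (0, 1) else if y = 2 then (1, 1) else (1, 0)

/-- The Gray map `Φ : Z₂^α × Z₄^β → Z₂^(α+2β)` (with index set `Fin α ⊕ Fin β × Fin 2`),
acting as the identity on the binary coordinates and as `grayPhi` coordinatewise on the
quaternary coordinates. -/
def grayMap {α β : ℕ} (u : Amb α β) : (Fin α ⊕ Fin β × Fin 2) → Z2 :=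
  Sum.elim (fun a => u.1 a)
    (fun b => if b.2 = 0 then (grayPhi (u.2 b.1)).1 else (grayPhi (u.2 b.1)).2)

/-- The minimum Hamming distance of a binary code `S` equals `d`. -/
def minDistEq {ι : Type} [Fintype ι] (S : Set (ι → Z2)) (d : ℕ) : Prop :=
  (∀ x ∈ S, ∀ y ∈ S, x ≠ y → d ≤ hammingDist x y) ∧
    ∃ x ∈ S, ∃ y ∈ S, x ≠ y ∧ hammingDist x y = d

/-- A quaternary linear perfect code of length `β = 2^(t-1)` (`t ≥ 3`): an additive
subgroup of `Z₄^β` whose Gray image has cardinality `2^(2β-t-1)` and minimum Hamming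
distance `4`. -/
def isQuatPerfect (t β : ℕ) (C : AddSubgroup (Amb 0 β)) : Prop :=
  3 ≤ t ∧ β = 2 ^ (t - 1) ∧
    Nat.card ↥(grayMap '' (C : Set (Amb 0 β))) = 2 ^ (2 * β - t - 1) ∧
    minDistEq (grayMap '' (C : Set (Amb 0 β))) 4

/-- An additive extended perfect code with `α ≠ 0` and binary length `α + 2β = 2^t`:
an additive subgroup of `Z₂^α × Z₄^β` with `α ≥ 1` whose Gray image has cardinality
`2^(2^t - t - 1)` and minimum Hamming distance `4`. -/
def isAddExtPerfect (t α β : ℕ) (C : AddSubgroup (Amb α β)) : Prop :=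
  1 ≤ α ∧ α + 2 * β = 2 ^ t ∧
    Nat.card ↥(grayMap '' (C : Set (Amb α β))) = 2 ^ (2 ^ t - t - 1) ∧
    minDistEq (grayMap '' (C : Set (Amb α β))) 4

section Duality

variable {α β : ℕ}

lemma addInner_comm (u v : Amb α β) : addInner u v = addInner v u := by
  simp only [addInner, mul_comm]

lemma addInner_add_right (u v v' : Amb α β) :
    addInner u (v + v') = addInner u v + addInner u v' := by
  rw [addInner_comm, addInner_add_left, addInner_comm v, addInner_comm v']

lemma addInner_neg_right (u v : Amb α β) : addInner u (-v) = -addInner u v := by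
  rw [addInner_comm, addInner_neg_left, addInner_comm v]

lemma addInner_zero_right (u : Amb α β) : addInner u 0 = 0 := by
  rw [addInner_comm, addInner_zero_left]

lemma addInner_binary_single (u : Amb α β) (i : Fin α) :
    addInner u (Pi.single i 1, 0) = 2 * ((u.1 i).val : Z4) := by
  simp only [addInner, Pi.zero_apply, mul_zero, Finset.sum_const_zero, add_zero]
  rw [Finset.sum_eq_single i]
  · simp [ZMod.val_one]
  · intro b _ hb
    simp [Pi.single_eq_of_ne hb]
  · simp

lemma addInner_quaternary_single (u : Amb α β) (j : Fin β) :
    addInner u (0, Pi.single j 1) = u.2 j := by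
  simp only [addInner, Pi.zero_apply, ZMod.val_zero, Nat.cast_zero, mul_zero,
    Finset.sum_const_zero, zero_add]
  rw [Finset.sum_eq_single j]
  · simp
  · intro b _ hb
    simp [Pi.single_eq_of_ne hb]
  · simp

lemma two_mul_val_eq_zero_iff : ∀ x : Z2, 2 * ((x.val : ℕ) : Z4) = 0 ↔ x = 0 := by decide

lemma eq_zero_of_addInner_eq_zero {u : Amb α β} (h : ∀ v, addInner u v = 0) : u = 0 := by
  refine Prod.ext (funext fun i => ?_) (funext fun j => ?_)
  · have := h (Pi.single i 1, 0)
    rw [addInner_binary_single] at this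
    exact (two_mul_val_eq_zero_iff _).1 this
  · have := h (0, Pi.single j 1)
    rwa [addInner_quaternary_single] at this

/-- The additive character `v ↦ i ^ ⟨u,v⟩` of the ambient group. -/
noncomputable def innerChar (u : Amb α β) : AddChar (Amb α β) ℂ where
  toFun v := ZMod.stdAddChar (addInner u v)
  map_zero_eq_one' := by rw [addInner_zero_right, AddChar.map_zero_eq_one]
  map_add_eq_mul' v v' := by rw [addInner_add_right, AddChar.map_add_eq_mul]

lemma innerChar_apply (u v : Amb α β) :
    innerChar u v = ZMod.stdAddChar (addInner u v) := rfl

lemma innerChar_comm (u v : Amb α β) : innerChar u v = innerChar v u := by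
  rw [innerChar_apply, innerChar_apply, addInner_comm]

lemma innerChar_apply_eq_one_iff (u v : Amb α β) :
    innerChar u v = 1 ↔ addInner u v = 0 := by
  rw [innerChar_apply]
  constructor
  · intro h
    apply ZMod.injective_stdAddChar (N := 4)
    rw [h, AddChar.map_zero_eq_one]
  · intro h
    rw [h, AddChar.map_zero_eq_one]

lemma innerChar_eq_one_iff (u : Amb α β) : innerChar u = 1 ↔ u = 0 := by
  constructor
  · intro h
    refine eq_zero_of_addInner_eq_zero fun v => ?_
    rw [← innerChar_apply_eq_one_iff, h, AddChar.one_apply]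
  · rintro rfl
    ext v
    rw [AddChar.one_apply, innerChar_apply_eq_one_iff, addInner_zero_left]

lemma mem_dualCode {C : AddSubgroup (Amb α β)} {u : Amb α β} :
    u ∈ dualCode C ↔ ∀ v ∈ C, addInner u v = 0 := Iff.rfl

open Classical in
/-- The MacWilliams-type cardinality identity `|C| |C^⊥| = |Z₂^α × Z₄^β|`. -/
lemma card_mul_card_dualCode (C : AddSubgroup (Amb α β)) :
    Nat.card C * Nat.card (dualCode C) = Nat.card (Amb α β) := by
  have h1 : ∑ u : Amb α β, ∑ c : C, innerChar u (c : Amb α β)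
      = (Nat.card C : ℂ) * (Nat.card (dualCode C) : ℂ) := by
    have key : ∀ u : Amb α β, ∑ c : C, innerChar u (c : Amb α β)
        = if u ∈ dualCode C then (Nat.card C : ℂ) else 0 := by
      intro u
      have := AddChar.sum_eq_ite ((innerChar u).compAddMonoidHom C.subtype)
      simp only [AddChar.compAddMonoidHom_apply, AddSubgroup.coe_subtype] at this
      rw [this, Nat.card_eq_fintype_card]
      refine if_congr ?_ rfl rfl
      rw [mem_dualCode, AddChar.eq_zero_iff]
      simp only [AddChar.compAddMonoidHom_apply, AddSubgroup.coe_subtype, Subtype.forall,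
        innerChar_apply_eq_one_iff]
    rw [Finset.sum_congr rfl fun u _ => key u, Finset.sum_ite, Finset.sum_const_zero, add_zero,
      Finset.sum_const, nsmul_eq_mul, mul_comm, Nat.card_eq_fintype_card (α := dualCode C),
      Fintype.card_subtype]
  have h2 : ∑ u : Amb α β, ∑ c : C, innerChar u (c : Amb α β) = (Nat.card (Amb α β) : ℂ) := by
    rw [Finset.sum_comm]
    have key : ∀ c : C, ∑ u : Amb α β, innerChar u (c : Amb α β)
        = if c = 0 then (Nat.card (Amb α β) : ℂ) else 0 := by
      intro c
      rw [Finset.sum_congr rfl fun u _ => innerChar_comm u c, AddChar.sum_eq_ite,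
        Nat.card_eq_fintype_card]
      refine if_congr ?_ rfl rfl
      rw [← ZeroMemClass.coe_eq_zero, ← innerChar_eq_one_iff]
      rfl
    rw [Finset.sum_congr rfl fun u _ => key u, Finset.sum_ite_eq' Finset.univ (0 : C)]
    simp
  exact_mod_cast h1.symm.trans h2

lemma dualCode_dualCode (C : AddSubgroup (Amb α β)) : dualCode (dualCode C) = C := by
  have hle : C ≤ dualCode (dualCode C) := fun c hc u hu => by
    rw [addInner_comm]
    exact hu c hc
  refine (AddSubgroup.eq_of_le_of_card_ge hle ?_).symm
  have h1 := card_mul_card_dualCode C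
  have h2 := card_mul_card_dualCode (dualCode C)
  have h3 : 0 < Nat.card (dualCode C) := Nat.card_pos
  refine le_of_eq (Nat.eq_of_mul_eq_mul_left h3 ?_)
  rw [h2, ← h1, mul_comm]

lemma mem_dualCode_zmultiples {u v : Amb α β} (h : addInner u v = 0) :
    u ∈ dualCode (AddSubgroup.zmultiples v) := by
  rintro _ ⟨m, rfl⟩
  have := map_zsmul (AddMonoidHom.mk' (addInner u) (addInner_add_right u)) m v
  simpa [h] using this

lemma dualCode_sup (A B : AddSubgroup (Amb α β)) :
    dualCode (A ⊔ B) = dualCode A ⊓ dualCode B := by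
  ext u
  rw [AddSubgroup.mem_inf]
  refine ⟨fun h => ⟨fun v hv => h v (AddSubgroup.mem_sup_left hv),
    fun v hv => h v (AddSubgroup.mem_sup_right hv)⟩, fun h v hv => ?_⟩
  obtain ⟨a, ha, b, hb, rfl⟩ := AddSubgroup.mem_sup.1 hv
  rw [addInner_add_right, h.1 a ha, h.2 b hb, add_zero]

lemma dualCode_inf (A B : AddSubgroup (Amb α β)) :
    dualCode (A ⊓ B) = dualCode A ⊔ dualCode B := by
  rw [← dualCode_dualCode (dualCode A ⊔ dualCode B), dualCode_sup, dualCode_dualCode,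
    dualCode_dualCode]

lemma card_amb : Nat.card (Amb α β) = 2 ^ (α + 2 * β) := by
  rw [Nat.card_eq_fintype_card, Fintype.card_prod, Fintype.card_fun, Fintype.card_fun,
    ZMod.card, ZMod.card, Fintype.card_fin, Fintype.card_fin, pow_add, pow_mul]
  norm_num

lemma card_preimage_double (C : AddSubgroup (Amb α β)) :
    Nat.card {x : Amb α β // x + x ∈ C}
      = Nat.card C * Nat.card {x : Amb α β // x ∈ dualCode C ∧ x + x = 0} := by
  let f : dualCode C →+ Amb α β := (dualCode C).subtype + (dualCode C).subtype
  have hf : ∀ h : dualCode C, f h = h + h := fun _ => rfl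
  have e1 : Nat.card f.ker = Nat.card {x : Amb α β // x ∈ dualCode C ∧ x + x = 0} :=
    Nat.card_congr
      { toFun := fun h => ⟨h.1.1, h.1.2, h.2⟩
        invFun := fun x => ⟨⟨x.1, x.2.1⟩, x.2.2⟩
        left_inv := fun _ => rfl
        right_inv := fun _ => rfl }
  have e2 : Nat.card {x : Amb α β // x + x ∈ C} = Nat.card (dualCode f.range) := by
    refine Nat.card_congr (Equiv.subtypeEquivRight fun x => ?_)
    have hd : x + x ∈ C ↔ x + x ∈ dualCode (dualCode C) := by rw [dualCode_dualCode]
    rw [hd, mem_dualCode, mem_dualCode]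
    have hs : ∀ h : Amb α β, addInner (x + x) h = addInner x (h + h) := fun h => by
      rw [addInner_add_left, addInner_add_right]
    constructor
    · rintro hx _ ⟨h, rfl⟩
      rw [hf, ← hs]
      exact hx h h.2
    · intro hx h hh
      rw [hs]
      exact hx _ ⟨⟨h, hh⟩, rfl⟩
  have h1 := card_mul_card_dualCode f.range
  have h2 := card_mul_card_dualCode C
  have h3 : Nat.card f.ker * Nat.card f.range = Nat.card (dualCode C) := by
    rw [← AddSubgroup.index_ker, AddSubgroup.card_mul_index]
  have h4 : 0 < Nat.card f.range := Nat.card_pos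
  rw [e2, ← e1]
  refine Nat.eq_of_mul_eq_mul_left h4 ?_
  rw [h1, ← h2, ← h3]
  ring

end Duality

section LeeWeight

variable {α β : ℕ}

/-- The Lee weight on `Z₄`. -/
def lee (z : Z4) : ℕ := min z.val (4 - z.val)

/-- The weight of the Gray image of a vector. -/
def leeWt (u : Amb α β) : ℕ := ∑ i, (u.1 i).val + ∑ j, lee (u.2 j)

lemma leeWt_zero : leeWt (0 : Amb α β) = 0 := by
  simp [leeWt, lee]

lemma eq_zero_of_leeWt_eq_zero {u : Amb α β} (h : leeWt u = 0) : u = 0 := by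
  have k1 : ∀ x : Z2, x.val = 0 → x = 0 := by decide
  have k2 : ∀ x : Z4, lee x = 0 → x = 0 := by decide
  simp only [leeWt, Nat.add_eq_zero_iff, Finset.sum_eq_zero_iff, Finset.mem_univ,
    true_implies] at h
  exact Prod.ext (funext fun i => k1 _ (h.1 i)) (funext fun j => k2 _ (h.2 j))

lemma leeWt_add_le (u v : Amb α β) : leeWt (u + v) ≤ leeWt u + leeWt v := by
  have k1 : ∀ x y : Z2, (x + y).val ≤ x.val + y.val := by decide
  have k2 : ∀ x y : Z4, lee (x + y) ≤ lee x + lee y := by decide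
  have e1 := Finset.sum_le_sum fun i (_ : i ∈ Finset.univ) => k1 (u.1 i) (v.1 i)
  have e2 := Finset.sum_le_sum fun i (_ : i ∈ Finset.univ) => k2 (u.2 i) (v.2 i)
  rw [Finset.sum_add_distrib] at e1 e2
  simp only [leeWt, Prod.fst_add, Prod.snd_add, Pi.add_apply]
  omega

lemma leeWt_neg (u : Amb α β) : leeWt (-u) = leeWt u := by
  have k1 : ∀ x : Z2, (-x).val = x.val := by decide
  have k2 : ∀ x : Z4, lee (-x) = lee x := by decide
  simp only [leeWt, Prod.fst_neg, Prod.snd_neg, Pi.neg_apply, k1, k2]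

lemma leeWt_sub_le (u v : Amb α β) : leeWt (u - v) ≤ leeWt u + leeWt v := by
  rw [sub_eq_add_neg, ← leeWt_neg v]
  exact leeWt_add_le _ _

lemma leeWt_add_parity (u v : Amb α β) : (leeWt (u + v) : Z2) = leeWt u + leeWt v := by
  have k1 : ∀ x y : Z2, (((x + y).val : ℕ) : Z2) = (x.val : ℕ) + (y.val : ℕ) := by decide
  have k2 : ∀ x y : Z4, ((lee (x + y) : ℕ) : Z2) = (lee x : ℕ) + (lee y : ℕ) := by decide
  simp only [leeWt, Prod.fst_add, Prod.snd_add, Pi.add_apply, Nat.cast_add, Nat.cast_sum, k1, k2,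
    Finset.sum_add_distrib]
  abel

lemma hammingDist_grayMap (u v : Amb α β) :
    hammingDist (grayMap u) (grayMap v) = leeWt (u - v) := by
  have k1 : ∀ x y : Z2, (if x ≠ y then 1 else 0) = (x - y).val := by decide
  have k2 : ∀ x y : Z4, ((if (grayPhi x).1 ≠ (grayPhi y).1 then 1 else 0)
      + if (grayPhi x).2 ≠ (grayPhi y).2 then 1 else 0) = lee (x - y) := by decide
  rw [hammingDist, Finset.card_filter, Fintype.sum_sum_type, Fintype.sum_prod_type, leeWt]
  congr 1
  · exact Finset.sum_congr rfl fun i _ => k1 (u.1 i) (v.1 i)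
  · refine Finset.sum_congr rfl fun j _ => ?_
    rw [Fin.sum_univ_two]
    exact k2 (u.2 j) (v.2 j)

lemma grayMap_injective : Function.Injective (grayMap (α := α) (β := β)) := by
  intro u v h
  have := hammingDist_grayMap u v
  rw [h, hammingDist_self] at this
  exact sub_eq_zero.1 (eq_zero_of_leeWt_eq_zero this.symm)

lemma card_grayMap_image (C : AddSubgroup (Amb α β)) :
    Nat.card ↥(grayMap '' (C : Set (Amb α β))) = Nat.card C :=
  Nat.card_image_of_injective grayMap_injective _

lemma minDistEq_grayMap_image_iff (C : AddSubgroup (Amb α β)) {d : ℕ} (hd : d ≠ 0) :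
    minDistEq (grayMap '' (C : Set (Amb α β))) d ↔
      (∀ c ∈ C, c ≠ 0 → d ≤ leeWt c) ∧ ∃ c ∈ C, leeWt c = d := by
  constructor
  · rintro ⟨h, _, ⟨u, hu, rfl⟩, _, ⟨v, hv, rfl⟩, -, huv⟩
    refine ⟨fun c hc h0 => ?_, u - v, C.sub_mem hu hv, by rw [← huv, hammingDist_grayMap]⟩
    have := h _ ⟨c, hc, rfl⟩ _ ⟨0, C.zero_mem, rfl⟩ (grayMap_injective.ne h0)
    rwa [hammingDist_grayMap, sub_zero] at this
  · rintro ⟨h, c, hc, rfl⟩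
    refine ⟨?_, _, ⟨c, hc, rfl⟩, _, ⟨0, C.zero_mem, rfl⟩, ?_, ?_⟩
    · rintro _ ⟨u, hu, rfl⟩ _ ⟨v, hv, rfl⟩ huv
      rw [hammingDist_grayMap]
      refine h _ (C.sub_mem hu hv) fun h0 => huv ?_
      rw [sub_eq_zero.1 h0]
    · refine grayMap_injective.ne fun h0 => hd ?_
      rw [h0, leeWt_zero]
    · rw [hammingDist_grayMap, sub_zero]

end LeeWeight

section PerfectCode

variable {t α β : ℕ}

/-- The vectors of weight one, indexed by `Fin α ⊕ Fin β × Bool`; the Boolean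
chooses the sign of the quaternary unit vectors. -/
def unitVec : Fin α ⊕ Fin β × Bool → Amb α β
  | Sum.inl i => (Pi.single i 1, 0)
  | Sum.inr (j, b) => (0, Pi.single j (if b then 1 else -1))

lemma leeWt_unitVec (s : Fin α ⊕ Fin β × Bool) : leeWt (unitVec s : Amb α β) = 1 := by
  rcases s with i | ⟨j, b⟩
  · rw [leeWt, Finset.sum_eq_single i]
    · simp [unitVec, ZMod.val_one, lee]
    · intro k _ hk
      simp [unitVec, Pi.single_eq_of_ne hk]
    · simp
  · have k : ∀ b : Bool, lee (if b then 1 else -1) = 1 := by decide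
    rw [leeWt, Finset.sum_eq_single (s := (Finset.univ : Finset (Fin β))) j]
    · simp [unitVec, k]
    · intro k _ hk
      simp [unitVec, Pi.single_eq_of_ne hk, lee]
    · simp

lemma unitVec_injective : Function.Injective (unitVec : _ → Amb α β) := by
  have k0 : ∀ b : Bool, (if b then 1 else -1 : Z4) ≠ 0 := by decide
  have k1 : ∀ b c : Bool, (if b then 1 else -1 : Z4) = (if c then 1 else -1) → b = c := by decide
  rintro (i | ⟨j, b⟩) (i' | ⟨j', b'⟩) h
  · have h1 := congrFun (congrArg Prod.fst h) i
    by_cases hi : i = i'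
    · rw [hi]
    · simp [unitVec, Pi.single_eq_of_ne hi] at h1
  · have h1 := congrFun (congrArg Prod.fst h) i
    simp [unitVec] at h1
  · have h1 := congrFun (congrArg Prod.fst h) i'
    simp [unitVec] at h1
  · have h1 := congrFun (congrArg Prod.snd h) j
    by_cases hj : j = j'
    · subst hj
      simp only [unitVec, Pi.single_eq_same] at h1
      rw [k1 _ _ h1]
    · simp only [unitVec, Pi.single_eq_same, Pi.single_eq_of_ne hj] at h1
      exact absurd h1 (k0 _)

lemma unitVec_inl_add_self (i : Fin α) :
    unitVec (Sum.inl i) + unitVec (Sum.inl i) = (0 : Amb α β) := by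
  have k : ∀ x : Z2, x + x = 0 := by decide
  refine Prod.ext (funext fun l => k _) ?_
  simp [unitVec]

lemma leeWt_double_unitVec_inr (j : Fin β) (b : Bool) :
    leeWt (unitVec (Sum.inr (j, b)) + unitVec (Sum.inr (j, b)) : Amb α β) ≠ 0 := by
  intro h
  have h1 := congrFun (congrArg Prod.snd (eq_zero_of_leeWt_eq_zero h)) j
  have k : ∀ b : Bool, (if b then 1 else -1 : Z4) + (if b then 1 else -1) ≠ 0 := by decide
  simp only [unitVec, Prod.snd_add, Pi.add_apply, Pi.single_eq_same] at h1
  exact k b h1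

variable {C : AddSubgroup (Amb α β)}

lemma eq_of_unitVec_sub_mem (hC : ∀ c ∈ C, c ≠ 0 → 4 ≤ leeWt c)
    {s s' : Fin α ⊕ Fin β × Bool} (h : unitVec s - unitVec s' ∈ C) : s = s' := by
  by_contra hne
  have h1 := hC _ h (sub_ne_zero.2 (unitVec_injective.ne hne))
  have h2 := leeWt_sub_le (unitVec s) (unitVec s' : Amb α β)
  rw [leeWt_unitVec, leeWt_unitVec] at h2
  omega

lemma unitVec_sub_sub_notMem (hC : ∀ c ∈ C, c ≠ 0 → 4 ≤ leeWt c)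
    (a b c : Fin α ⊕ Fin β × Bool) : unitVec a - unitVec b - unitVec c ∉ C := by
  intro h
  have h2 := leeWt_sub_le (unitVec a - unitVec b) (unitVec c : Amb α β)
  have h3 := leeWt_sub_le (unitVec a) (unitVec b : Amb α β)
  rw [leeWt_unitVec] at h2
  rw [leeWt_unitVec, leeWt_unitVec] at h3
  have h0 : unitVec a - unitVec b - unitVec c = (0 : Amb α β) := by
    by_contra hne
    have := hC _ h hne
    omega
  have h4 : (unitVec a : Amb α β) = unitVec b + unitVec c := by
    rw [sub_sub, sub_eq_zero] at h0
    exact h0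
  have h5 := leeWt_add_parity (unitVec b) (unitVec c : Amb α β)
  rw [← h4, leeWt_unitVec, leeWt_unitVec, leeWt_unitVec] at h5
  revert h5
  decide

lemma unitVec_inl_of_double_mem (hC : ∀ c ∈ C, c ≠ 0 → 4 ≤ leeWt c)
    {s : Fin α ⊕ Fin β × Bool} (h : unitVec s + unitVec s ∈ C) : ∃ i, s = Sum.inl i := by
  rcases s with i | ⟨j, b⟩
  · exact ⟨i, rfl⟩
  · exfalso
    have h1 := leeWt_double_unitVec_inr (α := α) j b
    have h2 := hC _ h fun h0 => h1 (by rw [h0, leeWt_zero])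
    have h3 := leeWt_add_le (unitVec (Sum.inr (j, b))) (unitVec (Sum.inr (j, b)) : Amb α β)
    rw [leeWt_unitVec] at h3
    omega

/-- In an extended perfect code, each vector lies, up to a codeword and possibly one fixed
unit vector `unitVec c`, among the unit vectors. -/
lemma exists_unitVec_sub_mem (hC : ∀ c ∈ C, c ≠ 0 → 4 ≤ leeWt c)
    (hcard : Nat.card (Amb α β) = 2 * (α + 2 * β) * Nat.card C)
    (c : Fin α ⊕ Fin β × Bool) (x : Amb α β) :
    ∃ s, x - unitVec s ∈ C ∨ x - unitVec s - unitVec c ∈ C := by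
  let f : (Fin α ⊕ Fin β × Bool) × Bool × C → Amb α β := fun p =>
    unitVec p.1 + (if p.2.1 then unitVec c else 0) + p.2.2
  have hinj : Function.Injective f := by
    rintro ⟨s, b, u⟩ ⟨s', b', u'⟩ h
    simp only [f] at h
    cases b <;> cases b' <;> simp only [if_true, if_false, Bool.false_eq_true, add_zero] at h
    · have hs : s = s' := eq_of_unitVec_sub_mem hC (by
        have : unitVec s - unitVec s' = (u' - u : Amb α β) := by
          rw [sub_eq_sub_iff_add_eq_add, h]; abel
        rw [this]; exact C.sub_mem u'.2 u.2)
      subst hs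
      rw [Subtype.ext (add_left_cancel h)]
    · refine absurd ?_ (unitVec_sub_sub_notMem hC s s' c)
      have : unitVec s - unitVec s' - unitVec c = (u' - u : Amb α β) := by
        rw [sub_sub, sub_eq_sub_iff_add_eq_add, h]; abel
      rw [this]; exact C.sub_mem u'.2 u.2
    · refine absurd ?_ (unitVec_sub_sub_notMem hC s' s c)
      have : unitVec s' - unitVec s - unitVec c = (u - u' : Amb α β) := by
        rw [sub_sub, sub_eq_sub_iff_add_eq_add, ← h]; abel
      rw [this]; exact C.sub_mem u.2 u'.2
    · have hs : s = s' := eq_of_unitVec_sub_mem hC (by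
        have : unitVec s - unitVec s' = (u' - u : Amb α β) := by
          rw [sub_eq_sub_iff_add_eq_add]
          apply add_right_cancel (b := unitVec c)
          calc _ = unitVec s + unitVec c + (u : Amb α β) := by abel
            _ = _ := by rw [h]; abel
        rw [this]; exact C.sub_mem u'.2 u.2)
      subst hs
      rw [Subtype.ext (add_left_cancel h)]
  have hbij : Function.Bijective f := by
    refine hinj.bijective_of_nat_card_le (le_of_eq ?_)
    rw [hcard, Nat.card_prod, Nat.card_prod, Nat.card_sum, Nat.card_prod, Nat.card_fin,
      Nat.card_fin, Nat.card_eq_fintype_card (α := Bool), Fintype.card_bool]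
    ring
  obtain ⟨⟨s, b, u⟩, hx⟩ := hbij.2 x
  refine ⟨s, ?_⟩
  cases b
  · left
    rw [← hx]
    simp [f]
  · right
    rw [← hx]
    have : f (s, true, u) - unitVec s - unitVec c = u := by
      simp only [f, if_true]; abel
    rw [this]; exact u.2

lemma pow_le_of_card_involutions (hC : ∀ c ∈ C, c ≠ 0 → 4 ≤ leeWt c)
    (hcard : Nat.card (Amb α β) = 2 * (α + 2 * β) * Nat.card C) (hα : 1 ≤ α) {δ : ℕ}
    (hδ : Nat.card {x : Amb α β // x ∈ dualCode C ∧ x + x = 0} = 2 ^ (1 + δ)) : 2 ^ δ ≤ α := by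
  let i₀ : Fin α := ⟨0, hα⟩
  let f : Fin α × Bool × C → Amb α β := fun p =>
    (unitVec (Sum.inl p.1) : Amb α β) + (if p.2.1 then unitVec (Sum.inl i₀) else 0) + (p.2.2 : Amb α β)
  have key : ∀ x : {x : Amb α β // x + x ∈ C}, ∃ p, f p = x := by
    rintro ⟨x, hx⟩
    obtain ⟨s, hs | hs⟩ := exists_unitVec_sub_mem hC hcard (Sum.inl i₀) x
    · obtain ⟨i, rfl⟩ := unitVec_inl_of_double_mem hC (s := s) (by
        have : unitVec s + unitVec s = (x + x) - (x - unitVec s) - (x - unitVec s) := by abel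
        rw [this]; exact C.sub_mem (C.sub_mem hx hs) hs)
      exact ⟨(i, false, ⟨_, hs⟩), by simp [f]⟩
    · obtain ⟨i, rfl⟩ := unitVec_inl_of_double_mem hC (s := s) (by
        have : unitVec s + unitVec s = (x + x) - (x - unitVec s - unitVec (Sum.inl i₀))
            - (x - unitVec s - unitVec (Sum.inl i₀))
            - (unitVec (Sum.inl i₀) + unitVec (Sum.inl i₀)) := by abel
        rw [this, unitVec_inl_add_self, sub_zero]
        exact C.sub_mem (C.sub_mem hx hs) hs)
      exact ⟨(i, true, ⟨_, hs⟩), by simp only [f, if_true]; abel⟩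
  choose g hg using key
  have hginj : Function.Injective g := fun x y h => Subtype.ext (by rw [← hg x, ← hg y, h])
  have h1 := Nat.card_le_card_of_injective g hginj
  rw [card_preimage_double, hδ, Nat.card_prod, Nat.card_prod, Nat.card_fin,
    Nat.card_eq_fintype_card (α := Bool), Fintype.card_bool] at h1
  have h2 : 0 < Nat.card C := Nat.card_pos
  have h3 : Nat.card C * 2 ^ (1 + δ) ≤ Nat.card C * (2 * α) := by linarith
  have h4 := Nat.le_of_mul_le_mul_left h3 h2
  rw [pow_add, pow_one] at h4
  omega

/-- All words of the dual of an extended perfect code with at least three binary coordinates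
have even weight on the binary coordinates. -/
lemma binary_ones_mem (hC : ∀ c ∈ C, c ≠ 0 → 4 ≤ leeWt c)
    (hcard : Nat.card (Amb α β) = 2 * (α + 2 * β) * Nat.card C) (hα : 3 ≤ α) :
    ((fun _ => 1, 0) : Amb α β) ∈ C := by
  have hd : ((fun _ => 1, 0) : Amb α β) ∈ dualCode (dualCode C) := by
    intro h hh
    rw [addInner_comm]
    have hsum : addInner h (fun _ => 1, 0) = ∑ l, 2 * ((h.1 l).val : Z4) := by
      simp [addInner, ZMod.val_one, Finset.mul_sum]
    rw [hsum]
    obtain ⟨i, i', hne, hii⟩ := Fintype.exists_ne_map_eq_of_card_lt h.1 (by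
      rw [ZMod.card, Fintype.card_fin]; omega)
    have key : ∀ l : Fin α, ∃ m : Fin α,
        (unitVec (Sum.inl l) + unitVec (Sum.inl i) - unitVec (Sum.inl m)
          - unitVec (Sum.inl i') : Amb α β) ∈ C := by
      intro l
      obtain ⟨s, hs | hs⟩ := exists_unitVec_sub_mem hC hcard (Sum.inl i')
        (unitVec (Sum.inl l) + unitVec (Sum.inl i))
      · refine absurd ?_ (unitVec_sub_sub_notMem hC s (Sum.inl l) (Sum.inl i))
        rw [← neg_mem_iff]
        convert hs using 1
        abel
      · obtain ⟨m, rfl⟩ := unitVec_inl_of_double_mem hC (s := s) (by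
          have h2 := C.neg_mem (C.add_mem hs hs)
          have e1 := unitVec_inl_add_self (β := β) l
          have e2 := unitVec_inl_add_self (β := β) i
          have e3 := unitVec_inl_add_self (β := β) i'
          have : unitVec s + unitVec s =
            -(unitVec (Sum.inl l) + unitVec (Sum.inl i) - unitVec s - unitVec (Sum.inl i') +
              (unitVec (Sum.inl l) + unitVec (Sum.inl i) - unitVec s - unitVec (Sum.inl i')))
            + (unitVec (Sum.inl l) + unitVec (Sum.inl l))
            + (unitVec (Sum.inl i) + unitVec (Sum.inl i))
            - (unitVec (Sum.inl i') + unitVec (Sum.inl i') : Amb α β) := by abel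
          rw [this, e1, e2, e3, add_zero, add_zero, sub_zero]
          exact h2)
        exact ⟨m, hs⟩
    choose σ hσ using key
    have hval : ∀ l, 2 * ((h.1 l).val : Z4) + 2 * ((h.1 (σ l)).val : Z4) = 0 := by
      intro l
      have h1 := hh _ (hσ l)
      have k : ∀ a b c : Z2, 2 * ((a.val : ℕ) : Z4) + 2 * ((c.val : ℕ) : Z4)
          + -(2 * ((b.val : ℕ) : Z4)) + -(2 * ((c.val : ℕ) : Z4)) = 0 →
          2 * ((a.val : ℕ) : Z4) + 2 * ((b.val : ℕ) : Z4) = 0 := by decide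
      simp only [sub_eq_add_neg, addInner_add_right, addInner_neg_right, unitVec,
        addInner_binary_single, ← hii] at h1
      exact k _ _ _ h1
    refine Finset.sum_involution (fun l _ => σ l) (fun l _ => hval l) (fun l _ _ hl => hne ?_)
      (fun l _ => Finset.mem_univ _) (fun l _ => ?_)
    · have h1 := hσ l
      rw [hl] at h1
      refine Sum.inl_injective (eq_of_unitVec_sub_mem hC ?_)
      convert h1 using 1
      abel
    · have h1 := C.add_mem (hσ l) (hσ (σ l))
      refine Sum.inl_injective (eq_of_unitVec_sub_mem hC ?_)
      rw [← neg_mem_iff]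
      have e2 := unitVec_inl_add_self (β := β) i
      have e3 := unitVec_inl_add_self (β := β) i'
      have : -(unitVec (Sum.inl (σ (σ l))) - unitVec (Sum.inl l) : Amb α β) =
        (unitVec (Sum.inl l) + unitVec (Sum.inl i) - unitVec (Sum.inl (σ l))
          - unitVec (Sum.inl i')) +
        (unitVec (Sum.inl (σ l)) + unitVec (Sum.inl i) - unitVec (Sum.inl (σ (σ l)))
          - unitVec (Sum.inl i')) - (unitVec (Sum.inl i) + unitVec (Sum.inl i))
        + (unitVec (Sum.inl i') + unitVec (Sum.inl i')) := by abel
      rw [this, e2, e3, add_zero, sub_zero]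
      exact h1
  rwa [dualCode_dualCode] at hd

end PerfectCode

section Extension

variable {α β : ℕ} {G : AddSubgroup (Amb α β)} {v : Amb α β}

lemma exists_fin_of_mem_sup_zmultiples {n : ℕ} [NeZero n] (hn : n • v = 0) {x : Amb α β}
    (hx : x ∈ G ⊔ AddSubgroup.zmultiples v) : ∃ g ∈ G, ∃ m : Fin n, g + (m : ℕ) • v = x := by
  obtain ⟨g, hg, _, ⟨m, rfl⟩, rfl⟩ := AddSubgroup.mem_sup.1 hx
  have hpos : (0 : ℤ) < n := by exact_mod_cast Nat.pos_of_ne_zero (NeZero.ne n)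
  have hm0 := Int.emod_nonneg m hpos.ne'
  have hm1 := Int.emod_lt_of_pos m hpos
  refine ⟨g, hg, ⟨(m % n).toNat, by omega⟩, ?_⟩
  congr 1
  change (m % n).toNat • v = m • v
  rw [← natCast_zsmul, Int.toNat_of_nonneg hm0]
  conv_rhs => rw [← Int.mul_ediv_add_emod m n, add_zsmul, mul_comm, mul_zsmul, natCast_zsmul, hn,
    zsmul_zero, zero_add]

lemma add_nsmul_inj {n : ℕ} (hv : ∀ m : ℕ, m • v ∈ G → n ∣ m) {g g' : Amb α β}
    (hg : g ∈ G) (hg' : g' ∈ G) {m m' : Fin n} (h : g + (m : ℕ) • v = g' + (m' : ℕ) • v) :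
    g = g' ∧ m = m' := by
  wlog hle : (m' : ℕ) ≤ m generalizing g g' m m'
  · have := this hg' hg h.symm (by omega)
    exact ⟨this.1.symm, this.2.symm⟩
  obtain ⟨d, hd⟩ := Nat.exists_eq_add_of_le hle
  have hdv : d • v = g' - g := by
    rw [hd, add_nsmul] at h
    rw [eq_sub_iff_add_eq]
    apply add_right_cancel (b := (m' : ℕ) • v)
    rw [← h]
    abel
  have hdd := hv d (hdv ▸ G.sub_mem hg' hg)
  have hd0 : d = 0 := Nat.eq_zero_of_dvd_of_lt hdd (by omega)
  have hm : m = m' := Fin.ext (by omega)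
  subst hm
  exact ⟨add_right_cancel h, rfl⟩

lemma card_sup_zmultiples {n : ℕ} [NeZero n] (hn : n • v = 0) (hv : ∀ m : ℕ, m • v ∈ G → n ∣ m) :
    Nat.card ↥(G ⊔ AddSubgroup.zmultiples v) = Nat.card G * n := by
  let f : G × Fin n → ↥(G ⊔ AddSubgroup.zmultiples v) := fun p =>
    ⟨p.1 + (p.2 : ℕ) • v, AddSubgroup.add_mem _ (AddSubgroup.mem_sup_left p.1.2)
      (AddSubgroup.mem_sup_right (AddSubgroup.nsmul_mem _ (AddSubgroup.mem_zmultiples v) _))⟩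
  have hf : Function.Bijective f := by
    constructor
    · rintro ⟨⟨g, hg⟩, m⟩ ⟨⟨g', hg'⟩, m'⟩ h
      obtain ⟨h1, h2⟩ := add_nsmul_inj hv hg hg' (congrArg Subtype.val h)
      subst h1 h2
      rfl
    · rintro ⟨x, hx⟩
      obtain ⟨g, hg, m, rfl⟩ := exists_fin_of_mem_sup_zmultiples hn hx
      exact ⟨(⟨g, hg⟩, m), rfl⟩
  rw [← Nat.card_congr (Equiv.ofBijective f hf), Nat.card_prod, Nat.card_fin]

/-- The elements of order at most two of a code. -/
def involutions (G : AddSubgroup (Amb α β)) : AddSubgroup (Amb α β) where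
  carrier := {x | x ∈ G ∧ x + x = 0}
  zero_mem' := ⟨G.zero_mem, add_zero 0⟩
  add_mem' := by
    rintro a b ⟨ha, ha'⟩ ⟨hb, hb'⟩
    refine ⟨G.add_mem ha hb, ?_⟩
    rw [add_add_add_comm, ha', hb', add_zero]
  neg_mem' := by
    rintro a ⟨ha, ha'⟩
    refine ⟨G.neg_mem ha, ?_⟩
    rw [← neg_add, ha', neg_zero]

lemma mem_involutions {x : Amb α β} : x ∈ involutions G ↔ x ∈ G ∧ x + x = 0 := Iff.rfl

lemma involutions_sup_zmultiples_of_four (h4 : 4 • v = 0) (hv : ∀ m : ℕ, m • v ∈ G → 4 ∣ m) :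
    involutions (G ⊔ AddSubgroup.zmultiples v)
      = involutions G ⊔ AddSubgroup.zmultiples (2 • v) := by
  apply le_antisymm
  · rintro x ⟨hx, hxx⟩
    obtain ⟨g, hg, m, rfl⟩ := exists_fin_of_mem_sup_zmultiples h4 hx
    have e : g + (m : ℕ) • v + (g + (m : ℕ) • v) = g + g + (2 * (m : ℕ)) • v := by
      rw [two_mul, add_nsmul]; abel
    rw [e] at hxx
    have hmem : (2 * (m : ℕ)) • v ∈ G := by
      rw [eq_neg_of_add_eq_zero_right hxx]
      exact G.neg_mem (G.add_mem hg hg)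
    obtain ⟨a, ha⟩ := hv _ hmem
    have hma : (m : ℕ) = a * 2 := by omega
    have hgg : g + g = 0 := by
      rw [ha, mul_comm, mul_nsmul', h4, nsmul_zero, add_zero] at hxx
      exact hxx
    refine AddSubgroup.add_mem _ (AddSubgroup.mem_sup_left ⟨hg, hgg⟩)
      (AddSubgroup.mem_sup_right ?_)
    rw [hma, mul_nsmul']
    exact AddSubgroup.nsmul_mem _ (AddSubgroup.mem_zmultiples _) _
  · refine sup_le (fun x hx => ⟨AddSubgroup.mem_sup_left hx.1, hx.2⟩) ?_
    rw [AddSubgroup.zmultiples_le]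
    refine ⟨AddSubgroup.mem_sup_right
      (AddSubgroup.nsmul_mem _ (AddSubgroup.mem_zmultiples v) _), ?_⟩
    rw [← add_nsmul, h4]

lemma involutions_sup_zmultiples_of_two (h2 : 2 • v = 0) :
    involutions (G ⊔ AddSubgroup.zmultiples v) = involutions G ⊔ AddSubgroup.zmultiples v := by
  apply le_antisymm
  · rintro x ⟨hx, hxx⟩
    obtain ⟨g, hg, m, rfl⟩ := exists_fin_of_mem_sup_zmultiples h2 hx
    have e : g + (m : ℕ) • v + (g + (m : ℕ) • v) = g + g + (m : ℕ) • (2 • v) := by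
      rw [two_nsmul, nsmul_add]; abel
    rw [e, h2, nsmul_zero, add_zero] at hxx
    exact AddSubgroup.add_mem _ (AddSubgroup.mem_sup_left ⟨hg, hxx⟩)
      (AddSubgroup.mem_sup_right (AddSubgroup.nsmul_mem _ (AddSubgroup.mem_zmultiples _) _))
  · refine sup_le (fun x hx => ⟨AddSubgroup.mem_sup_left hx.1, hx.2⟩) ?_
    rw [AddSubgroup.zmultiples_le]
    exact ⟨AddSubgroup.mem_sup_right (AddSubgroup.mem_zmultiples v), by rw [← two_nsmul, h2]⟩

lemma isOfType_iff {γ δ : ℕ} : isOfType G γ δ ↔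
    Nat.card G = 2 ^ (γ + 2 * δ) ∧ Nat.card (involutions G) = 2 ^ (γ + δ) := Iff.rfl

lemma isOfTypeK_iff {γ δ κ : ℕ} : isOfTypeK G γ δ κ ↔ isOfType G γ δ ∧
    Nat.card ((involutions G).map (AddMonoidHom.fst (Fin α → Z2) (Fin β → Z4))) = 2 ^ κ := Iff.rfl

lemma two_dvd_of_nsmul_mem (h2 : 2 • v = 0) (hv : v ∉ G) (m : ℕ) (hm : m • v ∈ G) : 2 ∣ m := by
  rcases Nat.even_or_odd' m with ⟨a, rfl | rfl⟩
  · exact dvd_mul_right _ _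
  · rw [add_nsmul, mul_comm, mul_nsmul', h2, nsmul_zero, zero_add, one_nsmul] at hm
    exact absurd hm hv

lemma isOfType.sup_zmultiples_of_four {γ δ : ℕ} (hG : isOfType G γ δ) (h4 : 4 • v = 0)
    (hv : ∀ m : ℕ, m • v ∈ G → 4 ∣ m) :
    isOfType (G ⊔ AddSubgroup.zmultiples v) γ (δ + 1) := by
  rw [isOfType_iff] at hG ⊢
  rw [involutions_sup_zmultiples_of_four h4 hv, card_sup_zmultiples h4 hv,
    card_sup_zmultiples (n := 2), hG.1, hG.2]
  · constructor <;> ring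
  · rw [← mul_nsmul', h4]
  · refine two_dvd_of_nsmul_mem (by rw [← mul_nsmul', h4]) fun h => ?_
    have := hv 2 h.1
    omega

lemma isOfType.sup_zmultiples_of_two {γ δ : ℕ} (hG : isOfType G γ δ) (h2 : 2 • v = 0)
    (hv : v ∉ G) : isOfType (G ⊔ AddSubgroup.zmultiples v) (γ + 1) δ := by
  rw [isOfType_iff] at hG ⊢
  rw [involutions_sup_zmultiples_of_two h2,
    card_sup_zmultiples h2 (two_dvd_of_nsmul_mem h2 hv),
    card_sup_zmultiples h2 (two_dvd_of_nsmul_mem h2 fun h => hv (mem_involutions.1 h).1),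
    hG.1, hG.2]
  constructor <;> ring

lemma map_fst_sup_zmultiples_of_fst_eq_zero (hv : v.1 = 0) :
    (G ⊔ AddSubgroup.zmultiples v).map (AddMonoidHom.fst (Fin α → Z2) (Fin β → Z4))
      = G.map (AddMonoidHom.fst (Fin α → Z2) (Fin β → Z4)) := by
  rw [AddSubgroup.map_sup, AddMonoidHom.map_zmultiples, AddMonoidHom.coe_fst, hv,
    AddSubgroup.zmultiples_zero_eq_bot, sup_bot_eq]

lemma isOfTypeK.sup_zmultiples_of_four {γ δ κ : ℕ} (hG : isOfTypeK G γ δ κ) (h4 : 4 • v = 0)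
    (hv : ∀ m : ℕ, m • v ∈ G → 4 ∣ m) :
    isOfTypeK (G ⊔ AddSubgroup.zmultiples v) γ (δ + 1) κ := by
  refine ⟨hG.1.sup_zmultiples_of_four h4 hv, ?_⟩
  have h0 : (2 • v).1 = 0 := by
    have k : ∀ x : Z2, 2 • x = 0 := by decide
    exact funext fun i => k _
  have := (isOfTypeK_iff.1 hG).2
  rw [← map_fst_sup_zmultiples_of_fst_eq_zero h0,
    ← involutions_sup_zmultiples_of_four h4 hv] at this
  exact this

lemma isOfTypeK.sup_zmultiples_of_two {γ δ κ : ℕ} (hG : isOfTypeK G γ δ κ) (h2 : 2 • v = 0)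
    (hv : v ∉ G) (h0 : v.1 = 0) : isOfTypeK (G ⊔ AddSubgroup.zmultiples v) (γ + 1) δ κ := by
  refine ⟨hG.1.sup_zmultiples_of_two h2 hv, ?_⟩
  have := (isOfTypeK_iff.1 hG).2
  rw [← map_fst_sup_zmultiples_of_fst_eq_zero h0, ← involutions_sup_zmultiples_of_two h2] at this
  exact this

lemma isOfTypeK.sup_zmultiples_of_two' {γ δ κ : ℕ} (hG : isOfTypeK G γ δ κ) (h2 : 2 • v = 0)
    (h0 : ∀ g ∈ involutions G, g.1 ≠ v.1) :
    isOfTypeK (G ⊔ AddSubgroup.zmultiples v) (γ + 1) δ (κ + 1) := by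
  have hv : v ∉ G := fun h => h0 v ⟨h, by rw [← two_nsmul, h2]⟩ rfl
  refine isOfTypeK_iff.2 ⟨hG.1.sup_zmultiples_of_two h2 hv, ?_⟩
  have hK := (isOfTypeK_iff.1 hG).2
  let P : AddSubgroup (Amb α β) := (involutions G).map
    ((AddMonoidHom.inl _ _).comp (AddMonoidHom.fst (Fin α → Z2) (Fin β → Z4)))
  have hinj : Function.Injective (AddMonoidHom.inl (Fin α → Z2) (Fin β → Z4)) := fun a b h =>
    congrArg Prod.fst h
  have hP : Nat.card P = 2 ^ κ := by
    rw [← hK]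
    simp only [P]
    rw [← AddSubgroup.map_map]
    exact Nat.card_image_of_injective hinj _
  rw [involutions_sup_zmultiples_of_two h2, ← AddSubgroup.card_map_of_injective hinj]
  have e : ((involutions G ⊔ AddSubgroup.zmultiples v).map
      (AddMonoidHom.fst (Fin α → Z2) (Fin β → Z4))).map (AddMonoidHom.inl _ _)
      = P ⊔ AddSubgroup.zmultiples ((v.1, 0) : Amb α β) := by
    rw [AddSubgroup.map_map, AddSubgroup.map_sup, AddMonoidHom.map_zmultiples]
    rfl
  have h2' : 2 • ((v.1, 0) : Amb α β) = 0 := by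
    have h3 := congrArg Prod.fst h2
    exact Prod.ext h3 (smul_zero 2)
  rw [e, card_sup_zmultiples h2' (two_dvd_of_nsmul_mem h2' ?_), hP, pow_succ]
  rintro ⟨g, hg, hgv⟩
  have h3 := congrArg Prod.fst hgv
  exact h0 g hg h3

end Extension

section Quadrupling

variable {t α β δ : ℕ}

/-- A vector of `Z₂^(2α) × Z₄^(α+4β)` assembled from two binary blocks of length `α`, one
quaternary block of length `α` and four quaternary blocks of length `β`. -/
def blockVec (p : Fin 2 → Fin α → Z2) (q : Fin α → Z4) (r : Fin 4 → Fin β → Z4) :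
    Amb (2 * α) (α + 4 * β) :=
  (fun n => p (finProdFinEquiv.symm n).1 (finProdFinEquiv.symm n).2,
    Fin.addCases q fun n => r (finProdFinEquiv.symm n).1 (finProdFinEquiv.symm n).2)

lemma exists_eq_blockVec (d : Amb (2 * α) (α + 4 * β)) : ∃ p q r, d = blockVec p q r := by
  refine ⟨fun c x => d.1 (finProdFinEquiv (c, x)), fun x => d.2 (Fin.castAdd _ x),
    fun b j => d.2 (Fin.natAdd α (finProdFinEquiv (b, j))), ?_⟩
  refine Prod.ext (funext fun n => ?_) (funext fun n => ?_)
  · simp only [blockVec, Prod.mk.eta, Equiv.apply_symm_apply]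
  · refine Fin.addCases (fun x => ?_) (fun y => ?_) n
    · simp only [blockVec, Fin.addCases_left]
    · simp only [blockVec, Fin.addCases_right, Prod.mk.eta, Equiv.apply_symm_apply]

lemma blockVec_add (p p' : Fin 2 → Fin α → Z2) (q q' : Fin α → Z4) (r r' : Fin 4 → Fin β → Z4) :
    blockVec p q r + blockVec p' q' r' = blockVec (p + p') (q + q') (r + r') := by
  refine Prod.ext rfl (funext fun n => ?_)
  refine Fin.addCases (fun x => ?_) (fun y => ?_) n
  · simp only [blockVec, Prod.snd_add, Pi.add_apply, Fin.addCases_left]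
  · simp only [blockVec, Prod.snd_add, Pi.add_apply, Fin.addCases_right]

lemma blockVec_zero : blockVec 0 0 0 = (0 : Amb (2 * α) (α + 4 * β)) := by
  refine Prod.ext rfl (funext fun n => ?_)
  refine Fin.addCases (fun x => ?_) (fun y => ?_) n
  · simp only [blockVec, Fin.addCases_left, Pi.zero_apply, Prod.snd_zero]
  · simp only [blockVec, Fin.addCases_right, Pi.zero_apply, Prod.snd_zero]

lemma nsmul_blockVec (m : ℕ) (p : Fin 2 → Fin α → Z2) (q : Fin α → Z4) (r : Fin 4 → Fin β → Z4) :
    m • blockVec p q r = blockVec (m • p) (m • q) (m • r) := by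
  refine Prod.ext rfl (funext fun n => ?_)
  refine Fin.addCases (fun x => ?_) (fun y => ?_) n
  · simp only [blockVec, Prod.smul_snd, Pi.smul_apply, Fin.addCases_left]
  · simp only [blockVec, Prod.smul_snd, Pi.smul_apply, Fin.addCases_right]

lemma blockVec_fst_inj {p p' : Fin 2 → Fin α → Z2} {q q' : Fin α → Z4} {r r' : Fin 4 → Fin β → Z4}
    (h : (blockVec p q r).1 = (blockVec p' q' r').1) : p = p' := by
  funext c x
  have := congrFun h (finProdFinEquiv (c, x))
  simpa only [blockVec, Equiv.symm_apply_apply] using this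

lemma blockVec_inj {p p' : Fin 2 → Fin α → Z2} {q q' : Fin α → Z4} {r r' : Fin 4 → Fin β → Z4}
    (h : blockVec p q r = blockVec p' q' r') : p = p' ∧ q = q' ∧ r = r' := by
  refine ⟨blockVec_fst_inj (congrArg Prod.fst h), ?_, ?_⟩
  · funext x
    have := congrFun (congrArg Prod.snd h) (Fin.castAdd _ x)
    simpa only [blockVec, Fin.addCases_left] using this
  · funext b j
    have := congrFun (congrArg Prod.snd h) (Fin.natAdd α (finProdFinEquiv (b, j)))
    simpa only [blockVec, Fin.addCases_right, Equiv.symm_apply_apply] using this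

lemma sum_binary_blocks {M : Type*} [AddCommMonoid M] (f : Fin 2 → Fin α → M) :
    ∑ n : Fin (2 * α), f (finProdFinEquiv.symm n).1 (finProdFinEquiv.symm n).2
      = ∑ x, (f 0 x + f 1 x) := by
  rw [Equiv.sum_comp finProdFinEquiv.symm fun z : Fin 2 × Fin α => f z.1 z.2,
    Fintype.sum_prod_type, Fin.sum_univ_two, Finset.sum_add_distrib]

lemma sum_quaternary_blocks {M : Type*} [AddCommMonoid M] (f : Fin 4 → Fin β → M) :
    ∑ n : Fin (4 * β), f (finProdFinEquiv.symm n).1 (finProdFinEquiv.symm n).2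
      = ∑ j, ∑ b, f b j := by
  rw [Equiv.sum_comp finProdFinEquiv.symm fun z : Fin 4 × Fin β => f z.1 z.2,
    Fintype.sum_prod_type, Finset.sum_comm]

lemma addInner_blockVec (p p' : Fin 2 → Fin α → Z2) (q q' : Fin α → Z4)
    (r r' : Fin 4 → Fin β → Z4) :
    addInner (blockVec p q r) (blockVec p' q' r') =
      ∑ x, (2 * (((p 0 x).val : Z4) * (p' 0 x).val + (p 1 x).val * (p' 1 x).val) + q x * q' x)
        + ∑ j, ∑ b, r b j * r' b j := by
  rw [addInner, Fin.sum_univ_add]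
  simp only [blockVec, Fin.addCases_left, Fin.addCases_right]
  rw [sum_binary_blocks fun c x => (((p c x).val : ℕ) : Z4) * ((p' c x).val : ℕ),
    sum_quaternary_blocks fun b j => r b j * r' b j, ← add_assoc, Finset.mul_sum,
    ← Finset.sum_add_distrib]

lemma leeWt_blockVec (p : Fin 2 → Fin α → Z2) (q : Fin α → Z4) (r : Fin 4 → Fin β → Z4) :
    leeWt (blockVec p q r) =
      ∑ x, ((p 0 x).val + (p 1 x).val + lee (q x)) + ∑ j, ∑ b, lee (r b j) := by
  rw [leeWt, Fin.sum_univ_add]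
  simp only [blockVec, Fin.addCases_left, Fin.addCases_right]
  rw [sum_binary_blocks fun c x => (p c x).val,
    sum_quaternary_blocks fun b j => lee (r b j), ← add_assoc, ← Finset.sum_add_distrib]

/-- The embedding `(h₁ | h₂) ↦ (h₁, h₁ | 2h₁, h₂, h₂, h₂, h₂)`. -/
def quadHom : Amb α β →+ Amb (2 * α) (α + 4 * β) where
  toFun h := blockVec (fun _ => h.1) (fun x => 2 * ((h.1 x).val : Z4)) fun _ => h.2
  map_zero' := by
    rw [← blockVec_zero]
    congr 1
  map_add' u v := by
    have k : ∀ x y : Z2, 2 * (((x + y).val : ℕ) : Z4)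
      = 2 * ((x.val : ℕ) : Z4) + 2 * ((y.val : ℕ) : Z4) := by decide
    rw [blockVec_add]
    congr 1
    exact funext fun x => k _ _

lemma quadHom_apply (h : Amb α β) : quadHom h
    = blockVec (fun _ => h.1) (fun x => 2 * ((h.1 x).val : Z4)) fun _ => h.2 := rfl

lemma quadHom_injective : Function.Injective (quadHom (α := α) (β := β)) := by
  intro u v h
  rw [quadHom_apply, quadHom_apply] at h
  obtain ⟨h1, -, h2⟩ := blockVec_inj h
  exact Prod.ext (congrFun h1 0) (congrFun h2 0)

lemma involutions_map_quadHom (H : AddSubgroup (Amb α β)) :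
    involutions (H.map quadHom) = (involutions H).map quadHom := by
  ext x
  constructor
  · rintro ⟨⟨h, hh, rfl⟩, hx⟩
    refine ⟨h, ⟨hh, quadHom_injective ?_⟩, rfl⟩
    rw [map_add, map_zero]
    exact hx
  · rintro ⟨h, ⟨hh, hx⟩, rfl⟩
    refine ⟨⟨h, hh, rfl⟩, ?_⟩
    rw [← map_add, hx, map_zero]

lemma isOfType.map_quadHom {H : AddSubgroup (Amb α β)} {γ δ : ℕ} (hH : isOfType H γ δ) :
    isOfType (H.map quadHom) γ δ := by
  rw [isOfType_iff] at hH ⊢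
  rw [involutions_map_quadHom, AddSubgroup.card_map_of_injective quadHom_injective,
    AddSubgroup.card_map_of_injective quadHom_injective]
  exact hH

lemma isOfTypeK.map_quadHom {H : AddSubgroup (Amb α β)} {γ δ κ : ℕ} (hH : isOfTypeK H γ δ κ) :
    isOfTypeK (H.map quadHom) γ δ κ := by
  refine isOfTypeK_iff.2 ⟨hH.1.map_quadHom, ?_⟩
  have hK := (isOfTypeK_iff.1 hH).2
  let dup : (Fin α → Z2) →+ (Fin (2 * α) → Z2) :=
    ((AddMonoidHom.fst _ _).comp (quadHom (β := β))).comp (AddMonoidHom.inl _ _)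
  have hdup : Function.Injective dup := by
    intro u v h
    have h' : (quadHom ((u, 0) : Amb α β)).1 = (quadHom ((v, 0) : Amb α β)).1 := h
    rw [quadHom_apply, quadHom_apply] at h'
    exact congrFun (blockVec_fst_inj h') 0
  have e : ((involutions H).map quadHom).map (AddMonoidHom.fst _ _)
      = ((involutions H).map (AddMonoidHom.fst _ _)).map dup := by
    rw [AddSubgroup.map_map, AddSubgroup.map_map]
    rfl
  rw [involutions_map_quadHom, e, AddSubgroup.card_map_of_injective hdup, hK]

/-- The extra row `(s, s + 1 | ε, π₀, π₁, π₂, π₃)` of the quadrupled parity-check matrix. -/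
def quadRow (s : Fin α → Z2) (ε : Z4) (π : Fin 4 → Z4) : Amb (2 * α) (α + 4 * β) :=
  blockVec (fun c x => s x + ![0, 1] c) (fun _ => ε) fun b _ => π b

/-- The dual of the quadrupled code. -/
def quadDual (C : AddSubgroup (Amb α β)) (w : Amb (2 * α) (α + 4 * β)) :
    AddSubgroup (Amb (2 * α) (α + 4 * β)) :=
  (dualCode C).map quadHom ⊔ AddSubgroup.zmultiples w

lemma four_nsmul_eq_zero (u : Amb α β) : 4 • u = 0 := by
  have k1 : ∀ x : Z2, 4 • x = 0 := by decide
  have k2 : ∀ x : Z4, 4 • x = 0 := by decide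
  exact Prod.ext (funext fun _ => k1 _) (funext fun _ => k2 _)

/-- The two admissible orders in which the last coordinate runs through `Z₄`. -/
def IsQuadOrder (π : Fin 4 → Z4) : Prop := π = ![0, 1, 2, 3] ∨ π = ![0, 1, 3, 2]

lemma IsQuadOrder.zero_one {π : Fin 4 → Z4} (h : IsQuadOrder π) : π 0 = 0 ∧ π 1 = 1 := by
  rcases h with rfl | rfl <;> exact ⟨rfl, rfl⟩

lemma four_dvd_of_nsmul_quadRow_mem {H : AddSubgroup (Amb α β)} (hβ : 1 ≤ β) {s : Fin α → Z2}
    {ε : Z4} {π : Fin 4 → Z4} (hπ : IsQuadOrder π) (m : ℕ)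
    (hm : m • quadRow s ε π ∈ H.map quadHom) : 4 ∣ m := by
  obtain ⟨h, -, hh⟩ := hm
  rw [quadRow, nsmul_blockVec, quadHom_apply] at hh
  obtain ⟨-, -, hr⟩ := blockVec_inj hh
  have h0 := congrFun (congrFun hr 0) ⟨0, hβ⟩
  have h1 := congrFun (congrFun hr 1) ⟨0, hβ⟩
  simp only [Pi.smul_apply, hπ.zero_one, smul_zero, nsmul_one] at h0 h1
  rw [h0] at h1
  exact (ZMod.natCast_eq_zero_iff _ _).1 h1.symm

lemma exists_eq_of_mem_quad {H : AddSubgroup (Amb α β)} {s : Fin α → Z2}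
    {ε : Z4} {π : Fin 4 → Z4} {p : Fin 2 → Fin α → Z2} {q : Fin α → Z4} {r : Fin 4 → Fin β → Z4}
    (hx : blockVec p q r ∈ H.map quadHom ⊔ AddSubgroup.zmultiples (quadRow s ε π)) :
    ∃ h ∈ H, ∃ m : ℕ, (∀ c x, p c x = h.1 x + m * (s x + ![0, 1] c)) ∧
      (∀ x, q x = 2 * ((h.1 x).val : Z4) + m * ε) ∧ ∀ b j, r b j = h.2 j + m * π b := by
  obtain ⟨_, ⟨h, hh, rfl⟩, m, hm⟩ :=
    exists_fin_of_mem_sup_zmultiples (n := 4) (four_nsmul_eq_zero _) hx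
  rw [quadRow, nsmul_blockVec, quadHom_apply, blockVec_add] at hm
  obtain ⟨hp, hq, hr⟩ := blockVec_inj hm
  refine ⟨h, hh, m, fun c x => ?_, fun x => ?_, fun b j => ?_⟩
  · simp [← hp]
  · simp [← hq]
  · simp [← hr]

lemma forall_le_one_of_sum_le_three {ι : Type*} [Fintype ι] [DecidableEq ι] (a : ι → ℕ)
    (f : ι → Z4) (ha : ∑ i, a i ≤ 3) (hf : ∑ i, f i = 0) (h1 : ∀ i, a i ≤ 1 → f i = 0)
    (h2 : ∀ i, 2 ≤ a i → a i ≤ 3 → f i ≠ 0) (i : ι) : a i ≤ 1 := by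
  by_contra hi
  have hle : ∀ k, k ≠ i → a i + a k ≤ 3 := fun k hk => by
    rw [← Finset.sum_pair hk.symm]
    exact (Finset.sum_le_univ_sum_of_nonneg fun _ => Nat.zero_le _).trans ha
  have hi3 : a i ≤ 3 := (Finset.single_le_sum (fun _ _ => Nat.zero_le _) (Finset.mem_univ i)).trans ha
  refine h2 i (by omega) hi3 ?_
  rw [← hf, Finset.sum_eq_single i (fun k _ hk => h1 k ?_) (by simp)]
  have := hle k hk
  omega

/-- The vector `R d` with `⟨quadHom h, d⟩ = ⟨h, R d⟩`. -/
def quadFold (p : Fin 2 → Fin α → Z2) (q : Fin α → Z4) (r : Fin 4 → Fin β → Z4) : Amb α β :=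
  (fun x => p 0 x + p 1 x + ((q x).val : Z2), fun j => r 0 j + r 1 j + r 2 j + r 3 j)

lemma addInner_quadHom_blockVec (h : Amb α β) (p : Fin 2 → Fin α → Z2) (q : Fin α → Z4)
    (r : Fin 4 → Fin β → Z4) :
    addInner (quadHom h) (blockVec p q r) = addInner h (quadFold p q r) := by
  have k : ∀ u a b : Z2, ∀ c : Z4, 2 * (((u.val : ℕ) : Z4) * (a.val : ℕ) + (u.val : ℕ) * (b.val : ℕ))
      + 2 * ((u.val : ℕ) : Z4) * c
      = 2 * (((u.val : ℕ) : Z4) * ((a + b + ((c.val : ℕ) : Z2)).val : ℕ)) := by decide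
  rw [quadHom_apply, addInner_blockVec, addInner, Finset.mul_sum]
  congr 1
  · exact Finset.sum_congr rfl fun x _ => k _ _ _ _
  · refine Finset.sum_congr rfl fun j _ => ?_
    simp only [Fin.sum_univ_four, quadFold]
    ring

lemma leeWt_quadFold_le (p : Fin 2 → Fin α → Z2) (q : Fin α → Z4)
    (r : Fin 4 → Fin β → Z4) : leeWt (quadFold p q r) ≤ leeWt (blockVec p q r) := by
  have k1 : ∀ a b : Z2, ∀ c : Z4, (a + b + ((c.val : ℕ) : Z2)).val ≤ a.val + b.val + lee c := by
    decide
  have k2 : ∀ x y : Z4, lee (x + y) ≤ lee x + lee y := by decide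
  rw [leeWt_blockVec, leeWt]
  refine add_le_add (Finset.sum_le_sum fun x _ => k1 _ _ _) (Finset.sum_le_sum fun j _ => ?_)
  rw [Fin.sum_univ_four]
  refine (k2 _ _).trans (add_le_add_left ((k2 _ _).trans (add_le_add_left (k2 _ _) _)) _)

lemma four_le_leeWt_of_mem_dual_quadDual {C : AddSubgroup (Amb α β)}
    (hC : ∀ c ∈ C, c ≠ 0 → 4 ≤ leeWt c) {s : Fin α → Z2} {ε : Z4} {π : Fin 4 → Z4}
    (hε : ε = 1 ∨ ε = -1) (hπ : IsQuadOrder π) (d : Amb (2 * α) (α + 4 * β))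
    (hd : d ∈ dualCode (quadDual C (quadRow s ε π))) (hd0 : d ≠ 0) : 4 ≤ leeWt d := by
  by_contra hlt
  apply hd0
  obtain ⟨p, q, r, rfl⟩ := exists_eq_blockVec d
  have hw : addInner (quadRow s ε π) (blockVec p q r) = 0 := by
    rw [addInner_comm]
    exact hd _ (AddSubgroup.mem_sup_right (AddSubgroup.mem_zmultiples _))
  have hfold : quadFold p q r = 0 := by
    by_contra hne
    refine hlt ((hC _ ?_ hne).trans (leeWt_quadFold_le p q r))
    rw [← dualCode_dualCode C]
    intro h hh
    rw [addInner_comm, ← addInner_quadHom_blockVec, addInner_comm]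
    exact hd _ (AddSubgroup.mem_sup_left ⟨h, hh, rfl⟩)
  have hfx : ∀ x, p 0 x + p 1 x + ((q x).val : Z2) = 0 := fun x =>
    congrFun (congrArg Prod.fst hfold) x
  have hfj : ∀ j, r 0 j + r 1 j + r 2 j + r 3 j = 0 := fun j =>
    congrFun (congrArg Prod.snd hfold) j
  rw [quadRow, addInner_blockVec] at hw
  rw [leeWt_blockVec] at hlt
  have kx : ∀ a b : Z2, ∀ c : Z4, a + b + ((c.val : ℕ) : Z2) = 0 → a.val + b.val + lee c ≤ 1 →
      a = 0 ∧ b = 0 ∧ c = 0 := by decide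
  have kj : ∀ a b c d : Z4, a + b + c + d = 0 → lee a + lee b + lee c + lee d ≤ 1 →
      a = 0 ∧ b = 0 ∧ c = 0 ∧ d = 0 := by decide
  have kx' : ∀ s a b : Z2, ∀ e c : Z4, (e = 1 ∨ e = -1) → a + b + ((c.val : ℕ) : Z2) = 0 →
      2 ≤ a.val + b.val + lee c → a.val + b.val + lee c ≤ 3 →
      2 * ((((s + 0).val : ℕ) : Z4) * (a.val : ℕ) + ((s + 1).val : ℕ) * (b.val : ℕ)) + e * c ≠ 0 := by
    decide
  have kj' : ∀ a b c d : Z4, a + b + c + d = 0 → 2 ≤ lee a + lee b + lee c + lee d →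
      lee a + lee b + lee c + lee d ≤ 3 →
      0 * a + 1 * b + 2 * c + 3 * d ≠ 0 ∧ 0 * a + 1 * b + 3 * c + 2 * d ≠ 0 := by decide
  have key := forall_le_one_of_sum_le_three (ι := Fin α ⊕ Fin β)
    (Sum.elim (fun x => (p 0 x).val + (p 1 x).val + lee (q x)) fun j => ∑ b, lee (r b j))
    (Sum.elim (fun x => 2 * ((((s x + ![0, 1] 0 : Z2).val : ℕ) : Z4) * ((p 0 x).val : ℕ)
      + ((s x + ![0, 1] 1 : Z2).val : ℕ) * ((p 1 x).val : ℕ)) + ε * q x)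
      fun j => ∑ b, π b * r b j)
    (by rw [Fintype.sum_sum_type]; exact Nat.le_of_lt_succ (not_le.1 hlt))
    (by rw [Fintype.sum_sum_type]; exact hw)
    (by
      rintro (x | j) h
      · obtain ⟨h0, h1, h2⟩ := kx _ _ _ (hfx x) h
        simp [h0, h1, h2]
      · simp only [Sum.elim_inr, Fin.sum_univ_four] at h ⊢
        obtain ⟨h0, h1, h2, h3⟩ := kj _ _ _ _ (hfj j) h
        simp [h0, h1, h2, h3])
    (by
      rintro (x | j) h h'
      · exact kx' _ _ _ _ _ hε (hfx x) h h'
      · simp only [Sum.elim_inr, Fin.sum_univ_four] at h h' ⊢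
        rcases hπ with rfl | rfl
        · exact (kj' _ _ _ _ (hfj j) h h').1
        · exact (kj' _ _ _ _ (hfj j) h h').2)
  rw [← blockVec_zero]
  congr 1
  · funext c x
    obtain ⟨h0, h1, h2⟩ := kx _ _ _ (hfx x) (key (Sum.inl x))
    match c with
    | 0 => exact h0
    | 1 => exact h1
  · funext x
    exact (kx _ _ _ (hfx x) (key (Sum.inl x))).2.2
  · funext b j
    have h := key (Sum.inr j)
    simp only [Sum.elim_inr, Fin.sum_univ_four] at h
    obtain ⟨h0, h1, h2, h3⟩ := kj _ _ _ _ (hfj j) h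
    match b with
    | 0 => exact h0
    | 1 => exact h1
    | 2 => exact h2
    | 3 => exact h3

lemma exists_leeWt_eq_four (C : AddSubgroup (Amb α β)) (hα : 1 ≤ α) {s : Fin α → Z2} {ε : Z4}
    {π : Fin 4 → Z4} (hε : ε = 1 ∨ ε = -1) :
    ∃ d ∈ dualCode (quadDual C (quadRow s ε π)), leeWt d = 4 := by
  refine ⟨blockVec (fun _ => Pi.single ⟨0, hα⟩ 1) (Pi.single ⟨0, hα⟩ 2) 0, ?_, ?_⟩
  · rw [quadDual, dualCode_sup]
    constructor
    · rintro _ ⟨h, -, rfl⟩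
      have k0 : (1 + 1 + (((2 : Z4).val : ℕ) : Z2) : Z2) = 0 := by decide
      rw [addInner_comm, addInner_quadHom_blockVec]
      have : quadFold (fun _ => Pi.single ⟨0, hα⟩ 1) (Pi.single ⟨0, hα⟩ 2) 0 = (0 : Amb α β) := by
        refine Prod.ext (funext fun x => ?_) (funext fun j => by simp [quadFold])
        by_cases hx : x = ⟨0, hα⟩
        · subst hx
          simp only [quadFold, Pi.single_eq_same]
          exact k0
        · simp [quadFold, Pi.single_eq_of_ne hx]
      rw [this, addInner_zero_right]
    · have k : ∀ s : Z2, ∀ e : Z4, e = 1 ∨ e = -1 → 2 * ((((s + 0).val : ℕ) : Z4)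
        * ((1 : Z2).val : ℕ) + ((s + 1).val : ℕ) * ((1 : Z2).val : ℕ)) + e * 2 = 0 := by decide
      refine mem_dualCode_zmultiples ?_
      rw [addInner_comm, quadRow, addInner_blockVec, Finset.sum_eq_single ⟨0, hα⟩]
      · simp only [Pi.single_eq_same, Pi.zero_apply, mul_zero, Finset.sum_const_zero, add_zero]
        exact k _ _ hε
      · intro x _ hx
        simp [Pi.single_eq_of_ne hx]
      · simp
  · rw [leeWt_blockVec, Finset.sum_eq_single ⟨0, hα⟩]
    · simp [ZMod.val_one, lee]
      decide
    · intro x _ hx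
      simp [Pi.single_eq_of_ne hx, lee]
    · simp

lemma isAddExtPerfect_dual_quadDual {C : AddSubgroup (Amb α β)} (hC : isAddExtPerfect t α β C)
    (hd : isOfType (dualCode C) 1 δ) (hβ : 1 ≤ β) {s : Fin α → Z2} {ε : Z4} {π : Fin 4 → Z4}
    (hε : ε = 1 ∨ ε = -1) (hπ : IsQuadOrder π) :
    isAddExtPerfect (t + 2) (2 * α) (α + 4 * β) (dualCode (quadDual C (quadRow s ε π))) ∧
      isOfType (dualCode (dualCode (quadDual C (quadRow s ε π)))) 1 (δ + 1) := by
  obtain ⟨hα, hlen, hcard, hdist⟩ := hC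
  have hT : isOfType (quadDual C (quadRow s ε π)) 1 (δ + 1) :=
    hd.map_quadHom.sup_zmultiples_of_four (four_nsmul_eq_zero _)
      (four_dvd_of_nsmul_quadRow_mem hβ hπ)
  refine ⟨⟨by omega, by rw [pow_add, ← hlen]; ring, ?_, ?_⟩, ?_⟩
  · have h1 := card_mul_card_dualCode C
    have h2 := card_mul_card_dualCode (quadDual C (quadRow s ε π))
    rw [card_grayMap_image] at hcard ⊢
    rw [hcard, hd.1, card_amb, ← pow_add] at h1
    have h3 := Nat.pow_right_injective le_rfl h1
    rw [hT.1, card_amb] at h2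
    have h4 : t < 2 ^ t := Nat.lt_two_pow_self
    have h5 : 2 * α + 2 * (α + 4 * β)
        = (1 + 2 * (δ + 1)) + (2 ^ (t + 2) - (t + 2) - 1) := by
      rw [pow_add]
      omega
    rw [h5, pow_add 2 (1 + 2 * (δ + 1))] at h2
    exact Nat.eq_of_mul_eq_mul_left (pow_pos two_pos _) h2
  · rw [minDistEq_grayMap_image_iff _ (by norm_num)] at hdist ⊢
    exact ⟨four_le_leeWt_of_mem_dual_quadDual hdist.1 hε hπ, exists_leeWt_eq_four C hα hε⟩
  · rwa [dualCode_dualCode]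

lemma dualCode_inf_dual_quadDual (C₁ C₂ : AddSubgroup (Amb α β))
    (w₁ w₂ : Amb (2 * α) (α + 4 * β)) :
    dualCode (dualCode (quadDual C₁ w₁) ⊓ dualCode (quadDual C₂ w₂))
      = (dualCode (C₁ ⊓ C₂)).map quadHom ⊔ AddSubgroup.zmultiples w₁
        ⊔ AddSubgroup.zmultiples w₂ := by
  rw [dualCode_inf, dualCode_dualCode, dualCode_dualCode, quadDual, quadDual, sup_sup_sup_comm,
    ← AddSubgroup.map_sup, ← dualCode_inf, sup_assoc]

lemma sup_zmultiples_add {A : Type*} [AddCommGroup A] (G : AddSubgroup A) (w v : A) :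
    G ⊔ AddSubgroup.zmultiples w ⊔ AddSubgroup.zmultiples (w + v)
      = G ⊔ AddSubgroup.zmultiples w ⊔ AddSubgroup.zmultiples v := by
  have hw : w ∈ G ⊔ AddSubgroup.zmultiples w :=
    AddSubgroup.mem_sup_right (AddSubgroup.mem_zmultiples w)
  apply le_antisymm <;> refine sup_le le_sup_left ((AddSubgroup.zmultiples_le).2 ?_)
  · exact AddSubgroup.add_mem _ (AddSubgroup.mem_sup_left hw)
      (AddSubgroup.mem_sup_right (AddSubgroup.mem_zmultiples v))
  · have h1 : w + v ∈ G ⊔ AddSubgroup.zmultiples w ⊔ AddSubgroup.zmultiples (w + v) :=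
      AddSubgroup.mem_sup_right (AddSubgroup.mem_zmultiples _)
    have h2 := AddSubgroup.sub_mem _ h1 (AddSubgroup.mem_sup_left hw)
    rwa [add_sub_cancel_left] at h2

lemma isAddExtPerfect.dual_parameters {C : AddSubgroup (Amb α β)} (ht : 3 ≤ t)
    (hC : isAddExtPerfect t α β C) (hd : isOfType (dualCode C) 1 δ) :
    1 ≤ β ∧ 4 ≤ α ∧ ((fun _ => 1, 0) : Amb α β) ∈ C := by
  obtain ⟨hα, hlen, hcard, hdist⟩ := hC
  rw [card_grayMap_image] at hcard
  rw [minDistEq_grayMap_image_iff _ (by norm_num)] at hdist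
  have h4 : t < 2 ^ t := Nat.lt_two_pow_self
  have h1 := card_mul_card_dualCode C
  rw [hcard, hd.1, card_amb, ← pow_add] at h1
  have h3 := Nat.pow_right_injective le_rfl h1
  have hamb : Nat.card (Amb α β) = 2 * (α + 2 * β) * Nat.card C := by
    rw [card_amb, hcard, hlen, ← pow_succ', ← pow_add]
    congr 1
    omega
  have hδα := pow_le_of_card_involutions hdist.1 hamb hα hd.2
  have hδ : 2 ≤ δ := by omega
  have h4α : 4 ≤ α := le_trans (Nat.pow_le_pow_right (n := 2) (by norm_num) hδ) hδα
  refine ⟨?_, h4α, binary_ones_mem hdist.1 hamb (by omega)⟩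
  by_contra hβ
  have hall : Nat.card {x : Amb α β // x ∈ dualCode C ∧ x + x = 0} = Nat.card (dualCode C) := by
    refine Nat.card_congr (Equiv.subtypeEquivRight fun x => and_iff_left ?_)
    have k : ∀ x : Z2, x + x = 0 := by decide
    exact Prod.ext (funext fun i => k _) (funext fun j => absurd j.2 (by omega))
  rw [hd.2, hd.1] at hall
  have := Nat.pow_right_injective le_rfl hall
  omega

end Quadrupling

/-- quadrupling construction for additive extended perfect codes with
`α ≠ 0` of dual type `(α,β;1,δ)`. -/
theorem stmt15 {t α β δ i j k : ℕ} (ht : 3 ≤ t)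
    (C₁ C₂ : AddSubgroup (Amb α β))
    (h₁ : isAddExtPerfect t α β C₁) (h₂ : isAddExtPerfect t α β C₂)
    (hd₁ : isOfType (dualCode C₁) 1 δ) (hd₂ : isOfType (dualCode C₂) 1 δ)
    (hint : isOfTypeK (dualCode (C₁ ⊓ C₂)) i j k) :
    ∀ p ∈ ({(i, j + 1, k), (i, j + 2, k), (i + 1, j + 1, k), (i + 1, j + 1, k + 1)} :
        Set (ℕ × ℕ × ℕ)),
      ∃ D₁ D₂ : AddSubgroup (Amb (2 * α) (α + 4 * β)),
        isAddExtPerfect (t + 2) (2 * α) (α + 4 * β) D₁ ∧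
        isAddExtPerfect (t + 2) (2 * α) (α + 4 * β) D₂ ∧
        isOfType (dualCode D₁) 1 (δ + 1) ∧ isOfType (dualCode D₂) 1 (δ + 1) ∧
        isOfTypeK (dualCode (D₁ ⊓ D₂)) p.1 p.2.1 p.2.2 := by
  obtain ⟨hβ, hα, hone₁⟩ := h₁.dual_parameters ht hd₁
  obtain ⟨-, -, hone₂⟩ := h₂.dual_parameters ht hd₂
  let π₀ : Fin 4 → Z4 := ![0, 1, 2, 3]
  let w₀ : Amb (2 * α) (α + 4 * β) := quadRow 0 1 π₀
  have hπ₀ : IsQuadOrder π₀ := Or.inl rfl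
  have hD₁ := isAddExtPerfect_dual_quadDual h₁ hd₁ hβ (s := 0) (Or.inl rfl) hπ₀
  have hG : isOfTypeK ((dualCode (C₁ ⊓ C₂)).map quadHom ⊔ AddSubgroup.zmultiples w₀) i (j + 1) k :=
    hint.map_quadHom.sup_zmultiples_of_four (four_nsmul_eq_zero _)
      (four_dvd_of_nsmul_quadRow_mem hβ hπ₀)
  -- It remains to choose the extra row of the second code.
  have main : ∀ (s : Fin α → Z2) (ε : Z4) (π : Fin 4 → Z4) (i' j' k' : ℕ),
      (ε = 1 ∨ ε = -1) → IsQuadOrder π →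
      isOfTypeK ((dualCode (C₁ ⊓ C₂)).map quadHom ⊔ AddSubgroup.zmultiples w₀
        ⊔ AddSubgroup.zmultiples (quadRow s ε π)) i' j' k' →
      ∃ D₁ D₂ : AddSubgroup (Amb (2 * α) (α + 4 * β)),
        isAddExtPerfect (t + 2) (2 * α) (α + 4 * β) D₁ ∧
        isAddExtPerfect (t + 2) (2 * α) (α + 4 * β) D₂ ∧
        isOfType (dualCode D₁) 1 (δ + 1) ∧ isOfType (dualCode D₂) 1 (δ + 1) ∧
        isOfTypeK (dualCode (D₁ ⊓ D₂)) i' j' k' := by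
    intro s ε π i' j' k' hε hπ hK
    have hD₂ := isAddExtPerfect_dual_quadDual h₂ hd₂ hβ (s := s) hε hπ
    refine ⟨_, _, hD₁.1, hD₂.1, hD₁.2, hD₂.2, ?_⟩
    rw [dualCode_inf_dual_quadDual]
    exact hK
  rintro p (rfl | rfl | rfl | rfl)
  · refine main 0 1 π₀ _ _ _ (Or.inl rfl) hπ₀ ?_
    rw [sup_assoc, sup_idem]
    exact hG
  · refine main 0 1 ![0, 1, 3, 2] _ _ _ (Or.inl rfl) (Or.inr rfl) ?_
    refine hG.sup_zmultiples_of_four (four_nsmul_eq_zero _) fun m hm => ?_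
    rw [quadRow, nsmul_blockVec] at hm
    obtain ⟨h, -, a, -, -, hr⟩ := exists_eq_of_mem_quad hm
    have k : ∀ h a m : Z4, m * 0 = h + a * 0 → m * 1 = h + a * 1 → m * 3 = h + a * 2 → m = 0 := by
      decide
    have hr' : ∀ b, (m : Z4) * (![0, 1, 3, 2] : Fin 4 → Z4) b = h.2 ⟨0, hβ⟩ + a * π₀ b := fun b => by
      rw [← hr b ⟨0, hβ⟩, Pi.smul_apply, Pi.smul_apply, nsmul_eq_mul]
    exact (ZMod.natCast_eq_zero_iff _ _).1 (k _ _ _ (hr' 0) (hr' 1) (hr' 2))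
  · have hv : (quadRow 0 (-1) π₀ : Amb (2 * α) (α + 4 * β)) = w₀ + blockVec 0 (fun _ => 2) 0 := by
      have k : (-1 : Z4) = 1 + 2 := by decide
      simp only [w₀, quadRow, blockVec_add, add_zero, k]
      rfl
    refine main 0 (-1) π₀ _ _ _ (Or.inr rfl) hπ₀ ?_
    rw [hv, sup_zmultiples_add]
    refine hG.sup_zmultiples_of_two ?_ (fun hm => ?_) rfl
    · rw [nsmul_blockVec, smul_zero, smul_zero, ← blockVec_zero]
      congr 1
    · obtain ⟨h, -, a, hp, hq, hr⟩ := exists_eq_of_mem_quad hm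
      have k1 : ∀ h a : Z4, 0 = h + a * 0 → 0 = h + a * 1 → a = 0 := by decide
      have k2 : ∀ x : Z2, ∀ a : Z4, 0 = x → a = 0 → 2 = 2 * ((x.val : ℕ) : Z4) + a * 1 → False := by
        decide
      have ha := k1 _ _ (hr 0 ⟨0, hβ⟩) (hr 1 ⟨0, hβ⟩)
      have hp0 := hp 0 ⟨0, by omega⟩
      simp only [Pi.zero_apply, Matrix.cons_val_zero, add_zero, mul_zero] at hp0
      exact k2 _ _ hp0 ha (hq ⟨0, by omega⟩)
  · let s : Fin α → Z2 := Pi.single ⟨0, by omega⟩ 1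
    have hv : (quadRow s 1 π₀ : Amb (2 * α) (α + 4 * β)) = w₀ + blockVec (fun _ => s) 0 0 := by
      simp only [w₀, quadRow, blockVec_add, add_zero]
      congr 1
      funext c x
      simp [add_comm]
    refine main s 1 π₀ _ _ _ (Or.inl rfl) hπ₀ ?_
    rw [hv, sup_zmultiples_add]
    refine hG.sup_zmultiples_of_two' ?_ fun g hg hgv => ?_
    · have k : ∀ x : Z2, 2 • x = 0 := by decide
      rw [nsmul_blockVec, smul_zero, smul_zero, ← blockVec_zero]
      congr 1
      exact funext fun _ => funext fun _ => k _
    · obtain ⟨p, q, r, rfl⟩ := exists_eq_blockVec g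
      obtain ⟨h, hh, a, hp, -, -⟩ := exists_eq_of_mem_quad hg.1
      have hps : p = fun _ => s := blockVec_fst_inj hgv
      have h20 : h.1 = s := by
        funext x
        have h0 := hp 0 x
        rw [hps] at h0
        simpa using h0.symm
      have hmem := hh _ (show ((fun _ => 1, 0) : Amb α β) ∈ C₁ ⊓ C₂ from ⟨hone₁, hone₂⟩)
      have hsum : addInner h (fun _ => 1, 0) = ∑ l, 2 * ((s l).val : Z4) := by
        simp [addInner, ZMod.val_one, Finset.mul_sum, h20]
      rw [hsum, Finset.sum_eq_single ⟨0, by omega⟩] at hmem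
      · simp only [s, Pi.single_eq_same] at hmem
        revert hmem
        decide
      · intro l _ hl
        simp [s, Pi.single_eq_of_ne hl]
      · simp
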